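/- arXiv:0709.1425 — 2 statements merged into one kernel-verified Lean document; each statement's English description precedes it below -/
import Mathlib

section
/- Let a<b be real, let p ∈ ]1,+∞[, and let ψ : ℝ → ]0,+∞[ be a bounded Borel function with ∫_{−∞}^{+∞} ψ(t)^{1/p} dt < +∞ and inf_K ψ > 0 for every compact K ⊂ ℝ. If u ∈ X^p_ψ(]a,b[) and v := Ψ_p∘(u')^a, then (u')^a is differentiable L¹-a.e. in ]a,b[ and v' = ψ^{1/p}((u')^a)·((u')^a)' L¹-a.e. in ]a,b[. -/
open MeasureTheory Filter Set Topology
open scoped ENNReal NNReal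

noncomputable section

/-- `Ψ₁(t) = ∫_{-∞}^t ψ(s) ds`. -/
def Psi1 (ψ : ℝ → ℝ) (t : ℝ) : ℝ := ∫ s in Set.Iic t, ψ s

/-- `Ψ_p(t) = ∫_{-∞}^t ψ(s)^{1/p} ds`. -/
def Psip (ψ : ℝ → ℝ) (p t : ℝ) : ℝ := ∫ s in Set.Iic t, ψ s ^ (1 / p)

/-- The natural extension of `Ψ₁` to the extended reals:
`Ψ₁(-∞) = 0`, `Ψ₁(+∞) = ∫_ℝ ψ`. -/
def Psi1E (ψ : ℝ → ℝ) (t : EReal) : ℝ :=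
  if t = ⊤ then ∫ s, ψ s else if t = ⊥ then 0 else Psi1 ψ t.toReal

/-- Standing assumptions on `ψ` in the case `p = 1`: a bounded, everywhere positive
Borel function, integrable on `ℝ`, whose infimum on every compact set is positive. -/
structure PsiHyp (ψ : ℝ → ℝ) : Prop where
  measurable : Measurable ψ
  pos : ∀ t, 0 < ψ t
  bounded : ∃ C, ∀ t, ψ t ≤ C
  integrable : MeasureTheory.Integrable ψ
  inf_pos : ∀ K : Set ℝ, IsCompact K → ∃ δ > 0, ∀ t ∈ K, δ ≤ ψ t

/-- Standing assumptions on `ψ` in the case `p > 1`: as in `PsiHyp` but with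
`ψ^{1/p}` integrable on `ℝ`. -/
structure PsiHypP (ψ : ℝ → ℝ) (p : ℝ) : Prop where
  measurable : Measurable ψ
  pos : ∀ t, 0 < ψ t
  bounded : ∃ C, ∀ t, ψ t ≤ C
  integrable : MeasureTheory.Integrable fun t => ψ t ^ (1 / p)
  inf_pos : ∀ K : Set ℝ, IsCompact K → ∃ δ > 0, ∀ t ∈ K, δ ≤ ψ t

/-- `(μp, μn)` is the Jordan decomposition of the distributional derivative of
`u ∈ L¹(]a,b[)`; the existence of such a pair encodes `u ∈ BV(]a,b[)`,
and `μp + μn` is the total variation measure `|u'|`. -/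
def IsDerivMeasures (a b : ℝ) (u : ℝ → ℝ) (μp μn : Measure ℝ) : Prop :=
  MeasureTheory.IntegrableOn u (Set.Ioo a b) ∧
  IsFiniteMeasure μp ∧ IsFiniteMeasure μn ∧ μp ⟂ₘ μn ∧
  μp (Set.Ioo a b)ᶜ = 0 ∧ μn (Set.Ioo a b)ᶜ = 0 ∧
  ∀ φ : ℝ → ℝ, ContDiff ℝ 1 φ → tsupport φ ⊆ Set.Ioo a b →
    ∫ x in Set.Ioo a b, u x * deriv φ x = (∫ x, φ x ∂μn) - ∫ x, φ x ∂μp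

/-- The density `(u')^a` of the absolutely continuous part of the derivative whose
Jordan decomposition is `(μp, μn)`. -/
def uaD (μp μn : Measure ℝ) (x : ℝ) : ℝ :=
  (μp.rnDeriv MeasureTheory.volume x).toReal - (μn.rnDeriv MeasureTheory.volume x).toReal

/-- Left approximate limit `u₋(y) = lim_{ε→0⁺} ε⁻¹ ∫_{y-ε}^y u`. -/
def leftApproxLim (u : ℝ → ℝ) (y : ℝ) : ℝ :=
  limUnder (𝓝[>] (0 : ℝ)) fun ε => (∫ x in Set.Ioo (y - ε) y, u x) / ε

/-- Right approximate limit `u₊(y) = lim_{ε→0⁺} ε⁻¹ ∫_y^{y+ε} u`. -/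
def rightApproxLim (u : ℝ → ℝ) (y : ℝ) : ℝ :=
  limUnder (𝓝[>] (0 : ℝ)) fun ε => (∫ x in Set.Ioo y (y + ε), u x) / ε

/-- Left approximate limit computed in the extended reals (may be `±∞`). -/
def leftApproxLimE (u : ℝ → ℝ) (y : ℝ) : EReal :=
  limUnder (𝓝[>] (0 : ℝ)) fun ε => (((∫ x in Set.Ioo (y - ε) y, u x) / ε : ℝ) : EReal)

/-- Right approximate limit computed in the extended reals (may be `±∞`). -/
def rightApproxLimE (u : ℝ → ℝ) (y : ℝ) : EReal :=
  limUnder (𝓝[>] (0 : ℝ)) fun ε => (((∫ x in Set.Ioo y (y + ε), u x) / ε : ℝ) : EReal)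

/-- The jump set `S_u` of `u` in `]a,b[`. -/
def jumpSet (a b : ℝ) (u : ℝ → ℝ) : Set ℝ :=
  {y | y ∈ Set.Ioo a b ∧ leftApproxLim u y ≠ rightApproxLim u y}

/-- `ν_u = sign(u₊ - u₋)`. -/
def jumpSign (u : ℝ → ℝ) (y : ℝ) : ℝ :=
  Real.sign (rightApproxLim u y - leftApproxLim u y)

/-- `Z⁺[w] = {x ∈ ]a,b[ : lim_{ε→0⁺} (2ε)⁻¹∫_{x-ε}^{x+ε} w = +∞}`. -/
def ZPlus (a b : ℝ) (w : ℝ → ℝ) : Set ℝ :=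
  {x | x ∈ Set.Ioo a b ∧
    Tendsto (fun ε => (∫ t in Set.Ioo (x - ε) (x + ε), w t) / (2 * ε)) (𝓝[>] (0 : ℝ)) atTop}

/-- `Z⁻[w] = {x ∈ ]a,b[ : lim_{ε→0⁺} (2ε)⁻¹∫_{x-ε}^{x+ε} w = -∞}`. -/
def ZMinus (a b : ℝ) (w : ℝ → ℝ) : Set ℝ :=
  {x | x ∈ Set.Ioo a b ∧
    Tendsto (fun ε => (∫ t in Set.Ioo (x - ε) (x + ε), w t) / (2 * ε)) (𝓝[>] (0 : ℝ)) atBot}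

/-- The positive part `((u')^c)⁺` of the Cantor part of the derivative of `u`:
the singular part of `μp` with the atoms on the jump set removed. -/
def cantorPos (a b : ℝ) (u : ℝ → ℝ) (μp : Measure ℝ) : Measure ℝ :=
  (μp.singularPart MeasureTheory.volume).restrict (jumpSet a b u)ᶜ

/-- The negative part `((u')^c)⁻` of the Cantor part of the derivative of `u`. -/
def cantorNeg (a b : ℝ) (u : ℝ → ℝ) (μn : Measure ℝ) : Measure ℝ :=
  (μn.singularPart MeasureTheory.volume).restrict (jumpSet a b u)ᶜ

/-- `u ∈ X¹_ψ(]a,b[)`, with derivative data `(μp, μn)`:  `u ∈ BV(]a,b[)`,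
`Ψ₁∘(u')^a ∈ BV(]a,b[)`, and `((u')^c)^±` is concentrated on `Z^±[(u')^a]`. -/
def MemX1 (ψ : ℝ → ℝ) (a b : ℝ) (u : ℝ → ℝ) (μp μn : Measure ℝ) : Prop :=
  IsDerivMeasures a b u μp μn ∧
  (∃ νp νn : Measure ℝ, IsDerivMeasures a b (fun x => Psi1 ψ (uaD μp μn x)) νp νn) ∧
  cantorPos a b u μp (ZPlus a b (uaD μp μn))ᶜ = 0 ∧
  cantorNeg a b u μn (ZMinus a b (uaD μp μn))ᶜ = 0

/-- `f ∈ W^{1,p}(]a,b[)`: `f` has an absolutely continuous representative whose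
pointwise a.e. derivative lies in `L^p(]a,b[)`. -/
def MemW1pOn (p a b : ℝ) (f : ℝ → ℝ) : Prop :=
  ∃ g w : ℝ → ℝ,
    (∀ᵐ x ∂(MeasureTheory.volume.restrict (Set.Ioo a b)), g x = f x) ∧
    MeasureTheory.IntegrableOn w (Set.Ioo a b) ∧
    MeasureTheory.IntegrableOn (fun x => |w x| ^ p) (Set.Ioo a b) ∧
    ∀ x ∈ Set.Ioo a b, ∀ y ∈ Set.Ioo a b, g y - g x = ∫ t in x..y, w t

/-- `u ∈ X^p_ψ(]a,b[)`, with derivative data `(μp, μn)`:  `u ∈ BV(]a,b[)`,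
`Ψ_p∘(u')^a ∈ W^{1,p}(]a,b[)`, and `((u')^s)^±` is concentrated on `Z^±[(u')^a]`. -/
def MemXp (ψ : ℝ → ℝ) (p a b : ℝ) (u : ℝ → ℝ) (μp μn : Measure ℝ) : Prop :=
  IsDerivMeasures a b u μp μn ∧
  MemW1pOn p a b (fun x => Psip ψ p (uaD μp μn x)) ∧
  (μp.singularPart MeasureTheory.volume) (ZPlus a b (uaD μp μn))ᶜ = 0 ∧
  (μn.singularPart MeasureTheory.volume) (ZMinus a b (uaD μp μn))ᶜ = 0

/-- `u ∈ W^{2,p}(]a,b[)` with first derivative `v` and second derivative `w`. -/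
def W2pRep (p a b : ℝ) (u v w : ℝ → ℝ) : Prop :=
  (∀ x ∈ Set.Ioo a b, HasDerivAt u (v x) x) ∧
  (∀ x ∈ Set.Ioo a b, ∀ y ∈ Set.Ioo a b, v y - v x = ∫ t in x..y, w t) ∧
  MeasureTheory.IntegrableOn u (Set.Ioo a b) ∧
  MeasureTheory.IntegrableOn v (Set.Ioo a b) ∧
  MeasureTheory.IntegrableOn w (Set.Ioo a b) ∧
  MeasureTheory.IntegrableOn (fun x => |w x| ^ p) (Set.Ioo a b)

/-- The functional `F_p(u) = ∫_a^b |u'| + ∫_a^b ψ(u')|u''|^p` if `u ∈ W^{2,p}(]a,b[)`,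
`+∞` otherwise (as an infimum over Sobolev representations). -/
def Fp (ψ : ℝ → ℝ) (p a b : ℝ) (u : ℝ → ℝ) : ℝ≥0∞ :=
  ⨅ (v : ℝ → ℝ) (w : ℝ → ℝ) (_ : W2pRep p a b u v w),
    ENNReal.ofReal ((∫ x in Set.Ioo a b, |v x|) + ∫ x in Set.Ioo a b, ψ (v x) * |w x| ^ p)

/-- Strong `L¹(]a,b[)` convergence of a sequence. -/
def TendstoL1 (a b : ℝ) (U : ℕ → ℝ → ℝ) (u : ℝ → ℝ) : Prop :=
  (∀ k, MeasureTheory.IntegrableOn (U k) (Set.Ioo a b)) ∧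
  MeasureTheory.IntegrableOn u (Set.Ioo a b) ∧
  Tendsto (fun k => ∫ x in Set.Ioo a b, |U k x - u x|) atTop (𝓝 0)

/-- The relaxed functional
`F̄_p(u) = inf { liminf_k F_p(u_k) : u_k → u in L¹(]a,b[) }`. -/
def FpRel (ψ : ℝ → ℝ) (p a b : ℝ) (u : ℝ → ℝ) : ℝ≥0∞ :=
  ⨅ (U : ℕ → ℝ → ℝ) (_ : TendstoL1 a b U u),
    liminf (fun k => Fp ψ p a b (U k)) atTop

/-- `Φ(s, t₁, t₂)` of the relaxation formula (`s` being the sign of the jump). -/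
def Phi (ψ : ℝ → ℝ) (s : ℝ) (t₁ t₂ : EReal) : ℝ :=
  if 0 < s then ((∫ t, ψ t) - Psi1E ψ t₁) + ((∫ t, ψ t) - Psi1E ψ t₂)
  else Psi1E ψ t₁ + Psi1E ψ t₂

/-- `Φ̂(s, t₁, t₂)` of Remark 2.5. -/
def PhiHat (ψ : ℝ → ℝ) (s : ℝ) (t₁ t₂ : EReal) : ℝ :=
  if 0 < s then (∫ t, ψ t) - Psi1E ψ (max t₁ t₂)
  else Psi1E ψ (min t₁ t₂)

/-- `ubar` is a `C¹([a,b])` representative of `u`. -/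
def C1Rep (a b : ℝ) (u ubar : ℝ → ℝ) : Prop :=
  (∀ᵐ x ∂(MeasureTheory.volume.restrict (Set.Ioo a b)), ubar x = u x) ∧
  ContDiffOn ℝ 1 ubar (Set.Icc a b)

/-- `u` solves `min { F̄₁(w) + λ ∫_a^b (w - G)² : w ∈ X¹_ψ(]a,b[) }`. -/
def IsSolution1 (ψ : ℝ → ℝ) (a b lam : ℝ) (G u : ℝ → ℝ) : Prop :=
  (∃ μp μn : Measure ℝ, MemX1 ψ a b u μp μn) ∧
  ∀ w : ℝ → ℝ, (∃ ηp ηn : Measure ℝ, MemX1 ψ a b w ηp ηn) →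
    FpRel ψ 1 a b u + ENNReal.ofReal (lam * ∫ x in Set.Ioo a b, (u x - G x) ^ 2) ≤
    FpRel ψ 1 a b w + ENNReal.ofReal (lam * ∫ x in Set.Ioo a b, (w x - G x) ^ 2)

/-- `u` solves `min { F̄_p(w) + λ ∫_a^b |w - G|² : w ∈ X^p_ψ(]a,b[) }`. -/
def IsSolutionP (ψ : ℝ → ℝ) (p a b lam : ℝ) (G u : ℝ → ℝ) : Prop :=
  (∃ μp μn : Measure ℝ, MemXp ψ p a b u μp μn) ∧
  ∀ w : ℝ → ℝ, (∃ ηp ηn : Measure ℝ, MemXp ψ p a b w ηp ηn) →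
    FpRel ψ p a b u + ENNReal.ofReal (lam * ∫ x in Set.Ioo a b, (u x - G x) ^ 2) ≤
    FpRel ψ p a b w + ENNReal.ofReal (lam * ∫ x in Set.Ioo a b, (w x - G x) ^ 2)

/-- The Rudin–Osher–Fatemi energy `|w'|(]a,b[) + λ∫_a^b (w-g)²`, where `(ηp, ηn)`
is the Jordan decomposition of the derivative of `w`. -/
def ROFenergy (a b lam : ℝ) (g w : ℝ → ℝ) (ηp ηn : Measure ℝ) : ℝ≥0∞ :=
  (ηp + ηn) (Set.Ioo a b) + ENNReal.ofReal (lam * ∫ x in Set.Ioo a b, (w x - g x) ^ 2)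

/-- The left-continuous generalized inverse `g^{-1}(c) = inf {x ∈ [a,b] : g(x) ≥ c}`. -/
def gInv (a b : ℝ) (g : ℝ → ℝ) (c : ℝ) : ℝ :=
  sInf {x | x ∈ Set.Icc a b ∧ c ≤ g x}

end

noncomputable section
open MeasureTheory Filter Set Topology
open scoped ENNReal NNReal

/-- Lipschitz images of Lebesgue null sets of the real line are null. -/
lemma LipschitzOnWith.volume_image_eq_zero {f : ℝ → ℝ} {K : ℝ≥0} {s : Set ℝ}
    (hf : LipschitzOnWith K f s) (hs : volume s = 0) : volume (f '' s) = 0 := by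
  have h := hf.hausdorffMeasure_image_le zero_le_one
  rw [hausdorffMeasure_real, hs, mul_zero] at h
  exact le_antisymm h bot_le

/-- A function with nonzero derivative at a point expands distances from that point. -/
lemma HasDerivAt.exists_nat_expanding {g : ℝ → ℝ} {d x : ℝ} (hg : HasDerivAt g d x)
    (hd : d ≠ 0) :
    ∃ n : ℕ, ∀ y, |y - x| < 1 / ((n : ℝ) + 1) → |y - x| ≤ ((n : ℝ) + 1) * |g y - g x| := by
  have hd' : 0 < |d| / 2 := by positivity
  have h := hg.isLittleO.def hd'
  obtain ⟨ε, hε, hball⟩ := Metric.eventually_nhds_iff.1 h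
  obtain ⟨n, hn⟩ := exists_nat_one_div_lt (lt_min hε hd')
  refine ⟨n, fun y hy => ?_⟩
  have hy' := hball (y := y) (by
    rw [Real.dist_eq]; exact hy.trans (hn.trans_le (min_le_left _ _)))
  simp only [Real.norm_eq_abs, smul_eq_mul] at hy'
  have h1 : |y - x| * |d| ≤ |g y - g x| + |d| / 2 * |y - x| := by
    rw [← abs_mul]
    calc |(y - x) * d| = |(g y - g x) - (g y - g x - (y - x) * d)| := by congr 1; ring
      _ ≤ |g y - g x| + |g y - g x - (y - x) * d| := abs_sub _ _
      _ ≤ _ := by gcongr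
  have h2 : 1 / ((n : ℝ) + 1) * |y - x| ≤ |g y - g x| := by
    have : 1 / ((n : ℝ) + 1) * |y - x| ≤ |d| / 2 * |y - x| := by
      exact mul_le_mul_of_nonneg_right (hn.trans_le (min_le_right _ _)).le (abs_nonneg _)
    linarith
  rw [one_div, inv_mul_le_iff₀ (by positivity)] at h2
  exact h2

/-- The derivative of a function vanishes a.e. on the preimage of a null set. -/
lemma volume_preimage_null_inter_deriv_ne_zero (g : ℝ → ℝ) {N : Set ℝ} (hN : volume N = 0) :
    volume {x | g x ∈ N ∧ ∃ d, d ≠ 0 ∧ HasDerivAt g d x} = 0 := by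
  set A : ℕ → Set ℝ := fun n => {x | g x ∈ N ∧
    ∀ y, |y - x| < 1 / ((n : ℝ) + 1) → |y - x| ≤ ((n : ℝ) + 1) * |g y - g x|} with hA
  refine measure_mono_null (t := ⋃ n, A n) ?_ (measure_iUnion_null fun n => ?_)
  · rintro x ⟨hx, d, hd, hgd⟩
    obtain ⟨n, hn⟩ := hgd.exists_nat_expanding hd
    exact mem_iUnion.2 ⟨n, hx, hn⟩
  · refine measure_null_of_locally_null _ fun x _ => ?_
    have hr : 0 < 1 / ((n : ℝ) + 1) / 2 := by positivity
    set B := A n ∩ Metric.ball x (1 / ((n : ℝ) + 1) / 2) with hB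
    refine ⟨B, inter_mem self_mem_nhdsWithin
      (mem_nhdsWithin_of_mem_nhds (Metric.ball_mem_nhds _ hr)), ?_⟩
    have hexp : ∀ y ∈ B, ∀ z ∈ B, |y - z| ≤ ((n : ℝ) + 1) * |g y - g z| := by
      intro y hy z hz
      refine hz.1.2 y ?_
      have h1 := Metric.mem_ball.1 hy.2
      have h2 := Metric.mem_ball'.1 hz.2
      have h3 := dist_triangle y x z
      rw [← Real.dist_eq]
      linarith
    have hinj : InjOn g B := by
      intro y hy z hz hyz
      have h := hexp y hy z hz
      rw [hyz, sub_self, abs_zero, mul_zero] at h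
      exact sub_eq_zero.1 (abs_nonpos_iff.1 h)
    have hlip : LipschitzOnWith ((n : ℝ≥0) + 1) (Function.invFunOn g B) (g '' B) := by
      refine LipschitzOnWith.of_dist_le_mul ?_
      rintro _ ⟨y, hy, rfl⟩ _ ⟨z, hz, rfl⟩
      rw [hinj.leftInvOn_invFunOn hy, hinj.leftInvOn_invFunOn hz, Real.dist_eq, Real.dist_eq]
      simpa using hexp y hy z hz
    have hnull : volume (g '' B) = 0 :=
      measure_mono_null (image_subset_iff.2 fun y hy => hy.1.1) hN
    refine measure_mono_null ?_ (hlip.volume_image_eq_zero hnull)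
    intro y hy
    exact ⟨g y, mem_image_of_mem g hy, hinj.leftInvOn_invFunOn hy⟩

/-- A left inverse of a continuous, locally expanding function is a local right inverse and
satisfies a Lipschitz estimate at every point of the range. -/
lemma exists_eventually_leftInverse_bound {F Q : ℝ → ℝ} (hF : Continuous F)
    (hQ : Function.LeftInverse Q F)
    (hexp : ∀ s t, ∃ δ > 0, ∀ x ∈ Icc s t, ∀ y ∈ Icc s t, δ * |y - x| ≤ |F y - F x|)
    (hmono : StrictMono F) (t : ℝ) :
    ∃ δ > 0, ∀ᶠ y in 𝓝 (F t), F (Q y) = y ∧ δ * |Q y - Q (F t)| ≤ |y - F t| := by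
  obtain ⟨δ, hδ, h⟩ := hexp (t - 1) (t + 1)
  refine ⟨δ, hδ, ?_⟩
  filter_upwards [Ioo_mem_nhds (hmono (sub_one_lt t)) (hmono (lt_add_one t))] with y hy
  obtain ⟨s, hs, rfl⟩ :=
    intermediate_value_Icc (by linarith : t - 1 ≤ t + 1) hF.continuousOn ⟨hy.1.le, hy.2.le⟩
  rw [hQ s, hQ t]
  exact ⟨rfl, h t ⟨by linarith, by linarith⟩ s hs⟩

/-- Chain rule for `Q ∘ g`, where `Q` inverts `F` near `g x` and satisfies a Lipschitz estimate
there; where `F` fails to have derivative `c`, the derivative of `g` is required to vanish. -/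
lemma HasDerivAt.comp_of_eventually_leftInverse {F Q g : ℝ → ℝ} {x w c δ : ℝ}
    (hg : HasDerivAt g w x) (hδ : 0 < δ) (hc : c ≠ 0)
    (hQ : ∀ᶠ y in 𝓝 (g x), F (Q y) = y ∧ δ * |Q y - Q (g x)| ≤ |y - g x|)
    (h : HasDerivAt F c (Q (g x)) ∨ w = 0) :
    HasDerivAt (fun x => Q (g x)) (c⁻¹ * w) x := by
  have hO : (fun y => Q y - Q (g x)) =O[𝓝 (g x)] fun y => y - g x := by
    refine Asymptotics.IsBigO.of_bound δ⁻¹ ?_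
    filter_upwards [hQ] with y hy
    rw [Real.norm_eq_abs, Real.norm_eq_abs, ← div_eq_inv_mul, le_div_iff₀' hδ]
    exact hy.2
  rcases h with h | rfl
  · have hcont : ContinuousAt Q (g x) := by
      have h0 : Tendsto (fun y => y - g x) (𝓝 (g x)) (𝓝 0) :=
        tendsto_sub_nhds_zero_iff.2 tendsto_id
      exact tendsto_sub_nhds_zero_iff.1 (hO.trans_tendsto h0)
    exact (h.of_local_left_inverse hcont hc (hQ.mono fun _ hy => hy.1)).comp x hg
  · rw [mul_zero, hasDerivAt_iff_isLittleO]
    have hlo := hg.isLittleO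
    simp only [smul_zero, sub_zero] at hlo ⊢
    exact (hO.comp_tendsto hg.continuousAt).trans_isLittleO hlo

/-- A function satisfying the fundamental theorem of calculus with an integrable density on an open
interval has that density as its derivative a.e. -/
lemma ae_hasDerivAt_of_sub_eq_integral {a b : ℝ} {g w : ℝ → ℝ} (hw : IntegrableOn w (Ioo a b))
    (hgw : ∀ x ∈ Ioo a b, ∀ y ∈ Ioo a b, g y - g x = ∫ t in x..y, w t) :
    ∀ᵐ x ∂(volume.restrict (Ioo a b)), HasDerivAt g (w x) x := by
  rw [ae_restrict_iff' measurableSet_Ioo]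
  have hI := (integrable_indicator_iff measurableSet_Ioo).2 hw
  filter_upwards [LocallyIntegrable.ae_hasDerivAt_integral hI.locallyIntegrable] with x hx hxab
  have h := (hx x).const_add (g x)
  rw [indicator_of_mem hxab] at h
  refine h.congr_of_eventuallyEq ?_
  filter_upwards [Ioo_mem_nhds hxab.1 hxab.2] with y hy
  have hint : ∫ t in x..y, (Ioo a b).indicator w t = ∫ t in x..y, w t :=
    intervalIntegral.integral_congr fun t ht =>
      indicator_of_mem (ordConnected_Ioo.uIcc_subset hxab hy ht) w
  rw [hint, ← hgw x hxab y hy]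
  ring

section Psip

variable {ψ : ℝ → ℝ} {p : ℝ}

lemma PsiHypP.rpow_pos (hψ : PsiHypP ψ p) (t : ℝ) : 0 < ψ t ^ (1 / p) :=
  Real.rpow_pos_of_pos (hψ.pos t) _

lemma PsiHypP.Psip_sub (hψ : PsiHypP ψ p) (s t : ℝ) :
    Psip ψ p t - Psip ψ p s = ∫ r in s..t, ψ r ^ (1 / p) :=
  intervalIntegral.integral_Iic_sub_Iic hψ.integrable.integrableOn hψ.integrable.integrableOn

lemma PsiHypP.exists_lipschitzWith_Psip (hψ : PsiHypP ψ p) (hp : 0 ≤ p) :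
    ∃ K, LipschitzWith K (Psip ψ p) := by
  obtain ⟨C, hC⟩ := hψ.bounded
  refine ⟨(C ^ (1 / p)).toNNReal, LipschitzWith.of_dist_le_mul fun t s => ?_⟩
  have hC0 : 0 ≤ C := (hψ.pos 0).le.trans (hC 0)
  rw [Real.dist_eq, Real.dist_eq, hψ.Psip_sub, Real.coe_toNNReal _ (Real.rpow_nonneg hC0 _),
    ← Real.norm_eq_abs]
  refine intervalIntegral.norm_integral_le_of_norm_le_const fun r _ => ?_
  rw [Real.norm_of_nonneg (hψ.rpow_pos r).le]
  exact Real.rpow_le_rpow (hψ.pos r).le (hC r) (by positivity)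

lemma PsiHypP.exists_expanding_Psip (hψ : PsiHypP ψ p) (hp : 0 ≤ p) (s t : ℝ) :
    ∃ δ > 0, ∀ x ∈ Icc s t, ∀ y ∈ Icc s t, x ≤ y → δ * (y - x) ≤ Psip ψ p y - Psip ψ p x := by
  obtain ⟨δ, hδ, h⟩ := hψ.inf_pos (Icc s t) isCompact_Icc
  refine ⟨δ ^ (1 / p), Real.rpow_pos_of_pos hδ _, fun x hx y hy hxy => ?_⟩
  rw [hψ.Psip_sub]
  have hle := intervalIntegral.integral_mono_on (μ := volume) (f := fun _ => δ ^ (1 / p)) hxy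
    intervalIntegrable_const hψ.integrable.intervalIntegrable fun r hr =>
      Real.rpow_le_rpow hδ.le (h r ⟨hx.1.trans hr.1, hr.2.trans hy.2⟩)
        (by positivity : (0 : ℝ) ≤ 1 / p)
  rw [intervalIntegral.integral_const, smul_eq_mul, mul_comm] at hle
  exact hle

lemma PsiHypP.strictMono_Psip (hψ : PsiHypP ψ p) (hp : 0 ≤ p) : StrictMono (Psip ψ p) := by
  intro s t hst
  obtain ⟨δ, hδ, h⟩ := hψ.exists_expanding_Psip hp s t
  have := h s (left_mem_Icc.2 hst.le) t (right_mem_Icc.2 hst.le) hst.le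
  nlinarith [mul_pos hδ (sub_pos.2 hst)]

lemma PsiHypP.ae_hasDerivAt_Psip (hψ : PsiHypP ψ p) :
    ∀ᵐ t, HasDerivAt (Psip ψ p) (ψ t ^ (1 / p)) t := by
  filter_upwards [LocallyIntegrable.ae_hasDerivAt_integral hψ.integrable.locallyIntegrable] with t ht
  refine ((ht t).const_add (Psip ψ p t)).congr_of_eventuallyEq (.of_forall fun s => ?_)
  simp only [← hψ.Psip_sub t s, add_sub_cancel]

end Psip


/-- chain rule for `u ∈ X^p_ψ(]a,b[)`:  `(u')ᵃ` is differentiable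
`L¹`-a.e. and `v' = ψ^{1/p}((u')ᵃ)·((u')ᵃ)'` a.e., where `v = Ψ_p∘(u')ᵃ`. -/
theorem statement_6 (a b p : ℝ) (hab : a < b) (hp : 1 < p)
    (ψ : ℝ → ℝ) (hψ : PsiHypP ψ p)
    (u : ℝ → ℝ) (μp μn : Measure ℝ) (hX : MemXp ψ p a b u μp μn)
    (g w : ℝ → ℝ)
    (hg : ∀ᵐ x ∂(MeasureTheory.volume.restrict (Set.Ioo a b)),
      g x = Psip ψ p (uaD μp μn x))
    (hw1 : MeasureTheory.IntegrableOn w (Set.Ioo a b))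
    (hwp : MeasureTheory.IntegrableOn (fun x => |w x| ^ p) (Set.Ioo a b))
    (hgw : ∀ x ∈ Set.Ioo a b, ∀ y ∈ Set.Ioo a b, g y - g x = ∫ t in x..y, w t) :
    ∃ utilde : ℝ → ℝ,
      (∀ᵐ x ∂(MeasureTheory.volume.restrict (Set.Ioo a b)), utilde x = uaD μp μn x) ∧
      ∀ᵐ x ∂(MeasureTheory.volume.restrict (Set.Ioo a b)),
        ∃ d : ℝ, HasDerivAt utilde d x ∧ w x = ψ (utilde x) ^ (1 / p) * d := by
  have hp0 : 0 ≤ p := by linarith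
  set F := Psip ψ p
  have hmono : StrictMono F := hψ.strictMono_Psip hp0
  have hQ : Function.LeftInverse (Function.invFun F) F :=
    Function.leftInverse_invFun hmono.injective
  set Q := Function.invFun F
  obtain ⟨K, hK⟩ := hψ.exists_lipschitzWith_Psip hp0
  have hexp : ∀ s t,
      ∃ δ > 0, ∀ x ∈ Icc s t, ∀ y ∈ Icc s t, δ * |y - x| ≤ |F y - F x| := by
    intro s t
    obtain ⟨δ, hδ, h⟩ := hψ.exists_expanding_Psip hp0 s t
    refine ⟨δ, hδ, fun x hx y hy => ?_⟩
    rcases le_total x y with hxy | hxy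
    · rw [abs_of_nonneg (sub_nonneg.2 hxy)]
      exact (h x hx y hy hxy).trans (le_abs_self _)
    · rw [abs_sub_comm, abs_sub_comm (F y), abs_of_nonneg (sub_nonneg.2 hxy)]
      exact (h y hy x hx hxy).trans (le_abs_self _)
  have hN : volume (F '' {t | ¬ HasDerivAt F (ψ t ^ (1 / p)) t}) = 0 :=
    hK.lipschitzOnWith.volume_image_eq_zero (ae_iff.1 hψ.ae_hasDerivAt_Psip)
  have hcrit : ∀ᵐ x, ¬ (g x ∈ F '' {t | ¬ HasDerivAt F (ψ t ^ (1 / p)) t} ∧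
      ∃ d, d ≠ 0 ∧ HasDerivAt g d x) := by
    rw [ae_iff]
    simpa only [not_not] using volume_preimage_null_inter_deriv_ne_zero g hN
  refine ⟨fun x => Q (g x), ?_, ?_⟩
  · filter_upwards [hg] with x hx
    rw [hx, hQ]
  · filter_upwards [hg, ae_hasDerivAt_of_sub_eq_integral hw1 hgw, ae_restrict_of_ae hcrit]
      with x hx hgx hxN
    obtain ⟨δ, hδ, hloc⟩ :=
      exists_eventually_leftInverse_bound (F := F) hK.continuous hQ hexp hmono (uaD μp μn x)
    rw [← hx] at hloc
    have hc := (hψ.rpow_pos (Q (g x))).ne'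
    refine ⟨_, hgx.comp_of_eventually_leftInverse hδ hc hloc ?_, ?_⟩
    · by_contra! hcon
      refine hxN ⟨⟨Q (g x), hcon.1, ?_⟩, w x, hcon.2, hgx⟩
      rw [hx, hQ]
    · rw [mul_inv_cancel_left₀ hc]
end
end

section
/- Let α > 1, define ψ : ℝ → ]0,+∞[ by ψ(t) := 1 if |t| ≤ 1 and ψ(t) := 1/|t|^α if |t| > 1, let p ∈ ]1,(α+1)/2[, and let 0 < β < 1 − (p−1)/(α−p). Define u : ]−1,1[ → ℝ by u(x) := −|x|^β for x ≤ 0 and u(x) := 1 + x^β for x > 0. Then the function Ψ_p∘(u')^a belongs to W^{1,p}(]−1,1[) and u ∈ X^p_ψ(]−1,1[); in particular X^p_ψ(]−1,1[) contains a discontinuous function. -/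
open MeasureTheory Filter Set Topology
open scoped ENNReal NNReal

noncomputable section
open MeasureTheory Filter Set Topology
open scoped ENNReal NNReal

/-! ### Powers of `|x|` -/

theorem intervalIntegrable_abs_rpow {s : ℝ} (hs : -1 < s) (a b : ℝ) :
    IntervalIntegrable (fun x : ℝ => |x| ^ s) volume a b := by
  refine intervalIntegrable_of_even (fun x => by rw [abs_neg]) (fun x hx => ?_)
  refine (intervalIntegral.intervalIntegrable_rpow' hs).congr (fun t ht => ?_)
  rw [uIoc_of_le hx.le] at ht
  simp only [abs_of_pos ht.1]

theorem integrableOn_Ioo_abs_rpow {s : ℝ} (hs : -1 < s) {a b : ℝ} (hab : a ≤ b) :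
    IntegrableOn (fun x : ℝ => |x| ^ s) (Ioo a b) :=
  (intervalIntegrable_iff_integrableOn_Ioo_of_le hab).1 (intervalIntegrable_abs_rpow hs a b)

theorem hasDerivAt_abs_rpow_of_ne_zero (s : ℝ) {x : ℝ} (hx : x ≠ 0) :
    HasDerivAt (fun x : ℝ => |x| ^ s) (s * |x| ^ (s - 1) * (SignType.sign x : ℝ)) x := by
  have := (hasDerivAt_abs hx).rpow_const (p := s) (Or.inl (abs_ne_zero.2 hx))
  convert this using 1
  ring

theorem tendsto_abs_rpow_neg {s : ℝ} (hs : s < 0) :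
    Tendsto (fun x : ℝ => |x| ^ s) (𝓝[≠] 0) atTop := by
  refine (tendsto_rpow_neg_nhdsGT_zero hs).comp ?_
  refine tendsto_nhdsWithin_iff.2 ⟨?_, ?_⟩
  · have : Tendsto (fun x : ℝ => |x|) (𝓝 0) (𝓝 0) := by
      simpa using (continuous_abs.tendsto (0 : ℝ))
    exact this.mono_left nhdsWithin_le_nhds
  · filter_upwards [self_mem_nhdsWithin] with x hx
    exact abs_pos.2 hx

/-- The odd power `sign x * |x| ^ β`. -/
def oddPow (β x : ℝ) : ℝ := max x 0 ^ β - max (-x) 0 ^ β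

theorem oddPow_of_nonneg {β x : ℝ} (hβ : 0 < β) (hx : 0 ≤ x) : oddPow β x = x ^ β := by
  simp [oddPow, hx, Real.zero_rpow hβ.ne']

theorem oddPow_of_nonpos {β x : ℝ} (hβ : 0 < β) (hx : x ≤ 0) : oddPow β x = -(|x| ^ β) := by
  simp [oddPow, hx, Real.zero_rpow hβ.ne', abs_of_nonpos hx]

theorem continuous_oddPow {β : ℝ} (hβ : 0 < β) : Continuous (oddPow β) := by
  unfold oddPow
  exact ((continuous_id.max continuous_const).rpow_const fun _ => Or.inr hβ.le).sub
    ((continuous_neg.max continuous_const).rpow_const fun _ => Or.inr hβ.le)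

theorem hasDerivAt_oddPow {β x : ℝ} (hβ : 0 < β) (hx : x ≠ 0) :
    HasDerivAt (oddPow β) (β * |x| ^ (β - 1)) x := by
  have key := hasDerivAt_abs_rpow_of_ne_zero β hx
  rcases lt_or_gt_of_ne hx with h | h
  · refine (key.neg.congr_of_eventuallyEq ?_).congr_deriv ?_
    · filter_upwards [Iio_mem_nhds h] with y hy
      exact oddPow_of_nonpos hβ (le_of_lt hy)
    · simp [sign_neg h]
  · refine (key.congr_of_eventuallyEq ?_).congr_deriv ?_
    · filter_upwards [Ioi_mem_nhds h] with y hy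
      rw [oddPow_of_nonneg hβ (le_of_lt hy), abs_of_pos hy]
    · simp [sign_pos h]

theorem integral_abs_rpow_sub_one {β : ℝ} (hβ : 0 < β) (a b : ℝ) :
    ∫ x in a..b, β * |x| ^ (β - 1) = oddPow β b - oddPow β a :=
  integral_eq_of_hasDerivAt_off_countable _ _ (countable_singleton (0 : ℝ))
    (continuous_oddPow hβ).continuousOn (fun _ hx => hasDerivAt_oddPow hβ hx.2)
    ((intervalIntegrable_abs_rpow (by linarith) a b).const_mul β)

/-! ### The primitive of `max 1 |t| ^ (-r)` -/

theorem continuous_max_one_abs_rpow (r : ℝ) : Continuous fun t : ℝ => max 1 |t| ^ (-r) :=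
  (continuous_const.max continuous_abs).rpow_const fun t =>
    Or.inl (lt_of_lt_of_le one_pos (le_max_left 1 |t|)).ne'

theorem integrable_max_one_abs_rpow {r : ℝ} (hr : 1 < r) :
    Integrable fun t : ℝ => max 1 |t| ^ (-r) := by
  have h := (integrable_one_add_norm (E := ℝ) (μ := volume) (r := r) (by simpa using hr)).const_mul
    (2 ^ r)
  refine h.mono' (continuous_max_one_abs_rpow r).aestronglyMeasurable (Eventually.of_forall ?_)
  intro t
  have h1 : (0 : ℝ) < 1 + |t| := by positivity
  have h2 : (0 : ℝ) < max 1 |t| := lt_of_lt_of_le one_pos (le_max_left 1 |t|)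
  rw [Real.norm_of_nonneg (Real.rpow_nonneg h2.le _), Real.norm_eq_abs]
  have h3 : (1 + |t|) / 2 ≤ max 1 |t| := by
    have := le_max_left 1 |t|
    have := le_max_right 1 |t|
    linarith
  calc max 1 |t| ^ (-r) ≤ ((1 + |t|) / 2) ^ (-r) :=
        Real.rpow_le_rpow_of_nonpos (by positivity) h3 (by linarith)
    _ = 2 ^ r * (1 + |t|) ^ (-r) := by
        rw [Real.div_rpow h1.le (by norm_num), Real.rpow_neg (by norm_num : (0 : ℝ) ≤ 2)]
        field_simp

theorem max_one_abs_rpow_le {r t : ℝ} (hr : 0 ≤ r) (ht : 0 < t) :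
    max 1 |t| ^ (-r) ≤ t ^ (-r) :=
  Real.rpow_le_rpow_of_nonpos ht ((le_abs_self t).trans (le_max_right _ _)) (by linarith)

theorem hasDerivAt_integral_Iic {h : ℝ → ℝ} (hc : Continuous h) (hi : Integrable h) (t : ℝ) :
    HasDerivAt (fun x => ∫ s in Iic x, h s) (h t) t := by
  have h1 : (fun x => ∫ s in Iic x, h s) = fun x => (∫ s in Iic 0, h s) + ∫ s in (0 : ℝ)..x, h s := by
    funext x
    rw [← intervalIntegral.integral_Iic_sub_Iic hi.integrableOn hi.integrableOn]
    ring
  rw [h1]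
  exact (hc.integral_hasStrictDerivAt 0 t).hasDerivAt.const_add _

theorem tendsto_integral_Iic {h : ℝ → ℝ} (hi : Integrable h) :
    Tendsto (fun x => ∫ s in Iic x, h s) atTop (𝓝 (∫ s, h s)) :=
  (aecover_Iic tendsto_id).integral_tendsto_of_countably_generated hi

/-- If `W(x) = ∫_{-∞}^{β|x|^{β-1}} max(1,|s|)^{-r} ds` and the exponent condition
`p (r (1 - β) + β - 2) > -1` holds, then `W` is in `W^{1,p}(]-1,1[)`. -/
theorem memW1pOn_integral_Iic {r p β : ℝ} (hr : 1 < r) (hp : 1 < p) (hβ0 : 0 < β) (hβ1 : β < 1)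
    (hexp : -1 < (r * (1 - β) + (β - 2)) * p) :
    MemW1pOn p (-1) 1
      (fun x => ∫ s in Iic (β * |x| ^ (β - 1)), max 1 |s| ^ (-r)) := by
  set h : ℝ → ℝ := fun s => max 1 |s| ^ (-r) with hh
  have hc : Continuous h := continuous_max_one_abs_rpow r
  have hi : Integrable h := integrable_max_one_abs_rpow hr
  set G : ℝ → ℝ := fun x => ∫ s in Iic (β * |x| ^ (β - 1)), h s with hG
  set g : ℝ → ℝ := Function.update G 0 (∫ s, h s) with hg
  set w : ℝ → ℝ := fun x => h (β * |x| ^ (β - 1)) *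
    (β * ((β - 1) * |x| ^ (β - 1 - 1) * (SignType.sign x : ℝ))) with hw
  have hGd : ∀ x, x ≠ 0 → HasDerivAt G (w x) x := fun x hx =>
    HasDerivAt.comp (h₂ := fun t => ∫ s in Iic t, h s) x
      (hasDerivAt_integral_Iic hc hi (β * |x| ^ (β - 1)))
      ((hasDerivAt_abs_rpow_of_ne_zero (β - 1) hx).const_mul β)
  have hgd : ∀ x, x ≠ 0 → HasDerivAt g (w x) x := fun x hx => by
    refine (hGd x hx).congr_of_eventuallyEq ?_
    filter_upwards [isOpen_ne.mem_nhds hx] with y hy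
    exact Function.update_of_ne hy _ _
  have hgc : Continuous g := by
    refine continuous_iff_continuousAt.2 fun x => ?_
    rcases eq_or_ne x 0 with rfl | hx
    · rw [hg, continuousAt_update_same]
      exact (tendsto_integral_Iic hi).comp
        ((tendsto_abs_rpow_neg (by linarith)).const_mul_atTop hβ0)
    · exact (hgd x hx).continuousAt
  have hwm : Measurable w := by
    have hs : Measurable fun x : ℝ => ((SignType.sign x : SignType) : ℝ) := by
      have : (fun x : ℝ => ((SignType.sign x : SignType) : ℝ)) =
          fun x => if 0 < x then 1 else if x < 0 then -1 else 0 := by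
        funext x
        rcases lt_trichotomy x 0 with hx | hx | hx
        · simp [hx, not_lt.2 hx.le]
        · simp [hx]
        · simp [hx]
      rw [this]
      exact Measurable.ite measurableSet_Ioi measurable_const
        (Measurable.ite measurableSet_Iio measurable_const measurable_const)
    have h1 : Measurable fun x : ℝ => |x| ^ (β - 1) := measurable_abs.pow_const _
    have h2 : Measurable fun x : ℝ => |x| ^ (β - 1 - 1) := measurable_abs.pow_const _
    exact (hc.measurable.comp (h1.const_mul β)).mul (((h2.const_mul _).mul hs).const_mul β)
  set C : ℝ := β ^ (-r) * (β * (1 - β)) with hC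
  have hC0 : 0 ≤ C := by
    have : 0 < 1 - β := by linarith
    positivity
  have hbound : ∀ x, x ≠ 0 → |w x| ≤ C * |x| ^ (r * (1 - β) + (β - 2)) := by
    intro x hx
    have hx' : 0 < |x| := abs_pos.2 hx
    have hpow : 0 < |x| ^ (β - 1) := Real.rpow_pos_of_pos hx' _
    have hs : |((SignType.sign x : SignType) : ℝ)| = 1 := by
      rcases lt_or_gt_of_ne hx with h' | h'
      · simp [sign_neg h']
      · simp [sign_pos h']
    have hh0 : 0 ≤ h (β * |x| ^ (β - 1)) := Real.rpow_nonneg (le_max_of_le_left zero_le_one) _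
    have e1 : |w x| = h (β * |x| ^ (β - 1)) * (β * (1 - β) * |x| ^ (β - 1 - 1)) := by
      simp only [hw, abs_mul, hs, abs_of_nonneg hh0, abs_of_pos hβ0,
        abs_of_neg (show β - 1 < 0 by linarith), abs_of_pos (Real.rpow_pos_of_pos hx' (β - 1 - 1))]
      ring
    have e2 : h (β * |x| ^ (β - 1)) ≤ β ^ (-r) * |x| ^ (r * (1 - β)) := by
      refine (max_one_abs_rpow_le (by linarith) (by positivity)).trans_eq ?_
      rw [Real.mul_rpow hβ0.le hpow.le, ← Real.rpow_mul hx'.le]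
      congr 2
      ring
    rw [e1, Real.rpow_add hx']
    have hnn : 0 ≤ β * (1 - β) * |x| ^ (β - 1 - 1) := by
      have : 0 < 1 - β := by linarith
      positivity
    refine (mul_le_mul_of_nonneg_right e2 hnn).trans_eq ?_
    rw [hC, show β - 1 - 1 = β - 2 by ring]
    ring
  have hne : ∀ᵐ x ∂(volume.restrict (Ioo (-1 : ℝ) 1)), x ≠ 0 :=
    ae_restrict_of_ae (Measure.ae_ne volume 0)
  have hwp : IntegrableOn (fun x => |w x| ^ p) (Ioo (-1 : ℝ) 1) := by
    refine ((integrableOn_Ioo_abs_rpow hexp (by norm_num)).const_mul (C ^ p)).mono'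
      (hwm.abs.pow_const p).aestronglyMeasurable ?_
    filter_upwards [hne] with x hx
    rw [Real.norm_of_nonneg (by positivity)]
    refine (Real.rpow_le_rpow (abs_nonneg _) (hbound x hx) (by linarith)).trans_eq ?_
    rw [Real.mul_rpow hC0 (by positivity), ← Real.rpow_mul (abs_nonneg x)]
  have hwi : IntegrableOn w (Ioo (-1 : ℝ) 1) := by
    have h1 : IntegrableOn (fun _ : ℝ => (1 : ℝ)) (Ioo (-1 : ℝ) 1) :=
      integrableOn_const (by simp)
    refine (h1.add hwp).mono' hwm.aestronglyMeasurable (Eventually.of_forall fun x => ?_)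
    simp only [Real.norm_eq_abs, Pi.add_apply]
    rcases le_total |w x| 1 with h' | h'
    · have : 0 ≤ |w x| ^ p := by positivity
      linarith
    · have := Real.rpow_le_rpow_of_exponent_le h' hp.le
      rw [Real.rpow_one] at this
      linarith
  refine ⟨g, w, ?_, hwi, hwp, fun x hx y hy => ?_⟩
  · filter_upwards [hne] with x hx
    exact Function.update_of_ne hx _ _
  · refine (integral_eq_of_hasDerivAt_off_countable g w (countable_singleton (0 : ℝ))
      hgc.continuousOn (fun t ht => hgd t ht.2) ?_).symm
    refine (hwi.mono_set ?_).intervalIntegrable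
    exact ordConnected_Ioo.uIcc_subset hx hy

theorem MemW1pOn.congr_ae {p a b : ℝ} {f₁ f₂ : ℝ → ℝ} (hf : MemW1pOn p a b f₁)
    (h : ∀ᵐ x ∂(volume.restrict (Ioo a b)), f₁ x = f₂ x) : MemW1pOn p a b f₂ := by
  obtain ⟨g, w, hg, hw⟩ := hf
  refine ⟨g, w, ?_, hw⟩
  filter_upwards [hg, h] with x h1 h2
  exact h1.trans h2

/-! ### The jump function -/

/-- `-|x|^β` for `x ≤ 0` and `1 + x^β` for `x > 0`. -/
def jumpPow (β x : ℝ) : ℝ := if x ≤ 0 then -(|x| ^ β) else 1 + x ^ β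

theorem jumpPow_eq {β : ℝ} (hβ : 0 < β) (x : ℝ) :
    jumpPow β x = oddPow β x + (Ioi (0 : ℝ)).indicator 1 x := by
  unfold jumpPow
  split_ifs with h
  · simp [oddPow_of_nonpos hβ h, h]
  · rw [oddPow_of_nonneg hβ (le_of_not_ge h), indicator_of_mem (by simpa using h)]
    simp [add_comm]

theorem integrableOn_jumpPow {β : ℝ} (hβ : 0 < β) : IntegrableOn (jumpPow β) (Ioo (-1 : ℝ) 1) := by
  have h1 : IntegrableOn (oddPow β) (Ioo (-1 : ℝ) 1) :=
    ((continuous_oddPow hβ).continuousOn.integrableOn_Icc).mono_set Ioo_subset_Icc_self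
  have h2 : IntegrableOn ((Ioi (0 : ℝ)).indicator (1 : ℝ → ℝ)) (Ioo (-1 : ℝ) 1) :=
    (integrableOn_const (C := (1 : ℝ)) (by simp)).indicator measurableSet_Ioi
  exact (h1.add h2).congr_fun (fun x _ => (jumpPow_eq hβ x).symm) measurableSet_Ioo

theorem not_continuous_representative_jumpPow (β : ℝ) :
    ¬ ∃ f : ℝ → ℝ, ContinuousOn f (Ioo (-1 : ℝ) 1) ∧
        ∀ᵐ x ∂(volume.restrict (Ioo (-1 : ℝ) 1)), f x = jumpPow β x := by
  rintro ⟨f, hf, hae⟩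
  have hc : ContinuousAt f 0 := hf.continuousAt (Ioo_mem_nhds (by norm_num) (by norm_num))
  rw [ae_restrict_iff' measurableSet_Ioo] at hae
  have key : ∀ s : Set ℝ, (∀ ε > 0, volume (s ∩ Ioo (-ε) ε) ≠ 0) → ∀ U ∈ 𝓝 (f 0),
      ∃ x ∈ s, jumpPow β x ∈ U := by
    intro s hs U hU
    obtain ⟨ε, hε, hsub⟩ := Metric.mem_nhds_iff.1
      (inter_mem (hc hU) (Ioo_mem_nhds (by norm_num : (-1 : ℝ) < 0) one_pos))
    by_contra! hno
    refine hs ε hε (measure_mono_null ?_ hae)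
    rintro x ⟨hxs, hx⟩ hx'
    have hxb := hsub (show x ∈ Metric.ball 0 ε by
      rw [Real.ball_eq_Ioo]; simpa using hx)
    refine hno x hxs ?_
    rw [← hx' hxb.2]
    exact hxb.1
  rcases lt_or_ge (f 0) 1 with h | h
  · obtain ⟨x, hx, hx'⟩ := key (Ioi 0) (fun ε hε => by
      have : Ioi (0 : ℝ) ∩ Ioo (-ε) ε = Ioo 0 ε := by
        ext y
        simp only [mem_inter_iff, mem_Ioi, mem_Ioo]
        constructor
        · rintro ⟨h1, h2, h3⟩; exact ⟨h1, h3⟩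
        · rintro ⟨h1, h2⟩; exact ⟨h1, by linarith, h2⟩
      simp [this, hε]) (Iio 1) (Iio_mem_nhds h)
    have h0 : 0 ≤ x ^ β := Real.rpow_nonneg (le_of_lt hx) β
    simp only [jumpPow, not_le.2 (show 0 < x from hx), if_false, mem_Iio] at hx'
    linarith
  · obtain ⟨x, hx, hx'⟩ := key (Iio 0) (fun ε hε => by
      have : Iio (0 : ℝ) ∩ Ioo (-ε) ε = Ioo (-ε) 0 := by
        ext y
        simp only [mem_inter_iff, mem_Iio, mem_Ioo]
        constructor
        · rintro ⟨h1, h2, h3⟩; exact ⟨h2, h1⟩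
        · rintro ⟨h1, h2⟩; exact ⟨h2, h1, by linarith⟩
      simp [this, hε]) (Ioi 0) (Ioi_mem_nhds (by linarith))
    have h0 : 0 ≤ |x| ^ β := Real.rpow_nonneg (abs_nonneg x) β
    simp only [jumpPow, le_of_lt (show x < 0 from hx), if_true, mem_Ioi] at hx'
    linarith

theorem integral_jumpPow_mul_deriv {β : ℝ} (hβ : 0 < β) {φ : ℝ → ℝ} (hφ : ContDiff ℝ 1 φ)
    (hsupp : tsupport φ ⊆ Ioo (-1 : ℝ) 1) :
    ∫ x in Ioo (-1 : ℝ) 1, jumpPow β x * deriv φ x =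
      -((∫ x in Ioo (-1 : ℝ) 1, β * |x| ^ (β - 1) * φ x) + φ 0) := by
  have hφ1 : φ 1 = 0 := image_eq_zero_of_notMem_tsupport fun h => by
    simpa using (hsupp h).2
  have hφ2 : φ (-1) = 0 := image_eq_zero_of_notMem_tsupport fun h => by
    simpa using (hsupp h).1
  have hd : Continuous (deriv φ) := hφ.continuous_deriv le_rfl
  have hφd : ∀ x, HasDerivAt φ (deriv φ x) x := fun x =>
    (hφ.differentiable one_ne_zero x).hasDerivAt
  have i1 : IntervalIntegrable (fun x => β * |x| ^ (β - 1) * φ x) volume (-1) 1 :=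
    ((intervalIntegrable_abs_rpow (by linarith) _ _).const_mul β).mul_continuousOn
      hφ.continuous.continuousOn
  have i2 : IntervalIntegrable (fun x => oddPow β x * deriv φ x) volume (-1) 1 :=
    ((continuous_oddPow hβ).mul hd).intervalIntegrable _ _
  have ibp : ∫ x in (-1 : ℝ)..1, (β * |x| ^ (β - 1) * φ x + oddPow β x * deriv φ x) = 0 := by
    have := integral_eq_of_hasDerivAt_off_countable (fun x => oddPow β x * φ x)
      (fun x => β * |x| ^ (β - 1) * φ x + oddPow β x * deriv φ x) (a := -1) (b := 1)
      (countable_singleton (0 : ℝ))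
      ((continuous_oddPow hβ).mul hφ.continuous).continuousOn
      (fun x hx => (hasDerivAt_oddPow hβ hx.2).mul (hφd x)) (i1.add i2)
    rw [this, hφ1, hφ2]
    ring
  rw [intervalIntegral.integral_add i1 i2] at ibp
  have step : ∫ x in Ioo (-1 : ℝ) 1, (Ioi (0 : ℝ)).indicator (deriv φ) x = -φ 0 := by
    rw [setIntegral_indicator measurableSet_Ioi]
    have : Ioo (-1 : ℝ) 1 ∩ Ioi 0 = Ioo 0 1 := by
      ext y
      simp only [mem_inter_iff, mem_Ioi, mem_Ioo]
      constructor
      · rintro ⟨⟨h1, h2⟩, h3⟩; exact ⟨h3, h2⟩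
      · rintro ⟨h1, h2⟩; exact ⟨⟨by linarith, h2⟩, h1⟩
    rw [this, ← integral_Ioc_eq_integral_Ioo, ← intervalIntegral.integral_of_le zero_le_one,
      intervalIntegral.integral_eq_sub_of_hasDerivAt (fun x _ => hφd x)
        (hd.intervalIntegrable _ _), hφ1]
    ring
  have i2' : IntegrableOn (fun x => oddPow β x * deriv φ x) (Ioo (-1 : ℝ) 1) :=
    (intervalIntegrable_iff_integrableOn_Ioo_of_le (by norm_num)).1 i2
  have i3 : IntegrableOn ((Ioi (0 : ℝ)).indicator (deriv φ)) (Ioo (-1 : ℝ) 1) :=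
    ((hd.continuousOn.integrableOn_Icc).mono_set Ioo_subset_Icc_self).indicator measurableSet_Ioi
  have split : ∀ x, jumpPow β x * deriv φ x =
      oddPow β x * deriv φ x + (Ioi (0 : ℝ)).indicator (deriv φ) x := by
    intro x
    rw [jumpPow_eq hβ, add_mul]
    by_cases hx : x ∈ Ioi (0 : ℝ) <;> simp [hx]
  simp_rw [split]
  rw [integral_add i2' i3, step, ← integral_Ioc_eq_integral_Ioo, ← integral_Ioc_eq_integral_Ioo,
    ← intervalIntegral.integral_of_le (by norm_num), ← intervalIntegral.integral_of_le (by norm_num)]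
  linarith

/-- The density `β|x|^{β-1}` on `]-1,1[`, extended by zero. -/
def jumpPowDensity (β x : ℝ) : ℝ≥0∞ :=
  (Ioo (-1 : ℝ) 1).indicator (fun x => ENNReal.ofReal (β * |x| ^ (β - 1))) x

theorem measurable_jumpPowDensity (β : ℝ) : Measurable (jumpPowDensity β) := by
  have h : Measurable fun x : ℝ => |x| ^ (β - 1) := measurable_abs.pow_const _
  exact (h.const_mul β).ennreal_ofReal.indicator measurableSet_Ioo

/-- The distributional derivative of `jumpPow β` on `]-1,1[`. -/
def jumpPowDeriv (β : ℝ) : Measure ℝ :=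
  Measure.dirac 0 + volume.withDensity (jumpPowDensity β)

theorem withDensity_jumpPowDensity (β : ℝ) :
    volume.withDensity (jumpPowDensity β) = (volume.restrict (Ioo (-1 : ℝ) 1)).withDensity
      fun x => ENNReal.ofReal (β * |x| ^ (β - 1)) :=
  withDensity_indicator measurableSet_Ioo _

theorem dirac_mutuallySingular_volume (x : ℝ) : Measure.dirac x ⟂ₘ (volume : Measure ℝ) :=
  mutuallySingular_dirac x volume

theorem rnDeriv_jumpPowDeriv (β : ℝ) :
    jumpPowDensity β =ᵐ[volume] (jumpPowDeriv β).rnDeriv volume :=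
  Measure.eq_rnDeriv (measurable_jumpPowDensity β) (dirac_mutuallySingular_volume 0) rfl

theorem singularPart_jumpPowDeriv (β : ℝ) :
    (jumpPowDeriv β).singularPart volume = Measure.dirac 0 :=
  (Measure.eq_singularPart (measurable_jumpPowDensity β) (dirac_mutuallySingular_volume 0) rfl).symm

theorem uaD_jumpPowDeriv {β : ℝ} (hβ : 0 < β) :
    ∀ᵐ x ∂(volume.restrict (Ioo (-1 : ℝ) 1)),
      uaD (jumpPowDeriv β) 0 x = β * |x| ^ (β - 1) := by
  filter_upwards [ae_restrict_of_ae (rnDeriv_jumpPowDeriv β),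
    ae_restrict_of_ae (Measure.rnDeriv_zero (volume : Measure ℝ)),
    ae_restrict_mem measurableSet_Ioo] with x h1 h2 hx
  rw [uaD, ← h1, h2, jumpPowDensity, indicator_of_mem hx, ENNReal.toReal_ofReal (by positivity)]
  simp

theorem integrableOn_jumpPow_deriv {β : ℝ} (hβ : 0 < β) :
    IntegrableOn (fun x : ℝ => β * |x| ^ (β - 1)) (Ioo (-1 : ℝ) 1) :=
  (integrableOn_Ioo_abs_rpow (by linarith) (by norm_num)).const_mul β

theorem isFiniteMeasure_withDensity_jumpPowDensity {β : ℝ} (hβ : 0 < β) :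
    IsFiniteMeasure (volume.withDensity (jumpPowDensity β)) := by
  rw [withDensity_jumpPowDensity]
  exact isFiniteMeasure_withDensity_ofReal (integrableOn_jumpPow_deriv hβ).2

theorem integral_jumpPowDeriv {β : ℝ} (hβ : 0 < β) {φ : ℝ → ℝ} (hφ : Continuous φ) :
    ∫ x, φ x ∂(jumpPowDeriv β) = (∫ x in Ioo (-1 : ℝ) 1, β * |x| ^ (β - 1) * φ x) + φ 0 := by
  have hm : Measurable fun x : ℝ => ENNReal.ofReal (β * |x| ^ (β - 1)) := by
    have h : Measurable fun x : ℝ => |x| ^ (β - 1) := measurable_abs.pow_const _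
    exact (h.const_mul β).ennreal_ofReal
  have e : ∀ x : ℝ, (ENNReal.ofReal (β * |x| ^ (β - 1))).toReal • φ x = β * |x| ^ (β - 1) * φ x :=
    fun x => by rw [ENNReal.toReal_ofReal (by positivity), smul_eq_mul]
  have hi : IntervalIntegrable (fun x => β * |x| ^ (β - 1) * φ x) volume (-1) 1 :=
    ((intervalIntegrable_abs_rpow (by linarith) _ _).const_mul β).mul_continuousOn hφ.continuousOn
  rw [jumpPowDeriv, integral_add_measure (integrable_dirac (by simp)), integral_dirac,
    withDensity_jumpPowDensity, integral_withDensity_eq_integral_toReal_smul hm (by simp)]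
  · simp_rw [e]
    ring
  · rw [withDensity_jumpPowDensity, integrable_withDensity_iff_integrable_smul' hm (by simp)]
    simp_rw [e]
    exact (intervalIntegrable_iff_integrableOn_Ioo_of_le (by norm_num)).1 hi

theorem isDerivMeasures_jumpPow {β : ℝ} (hβ : 0 < β) :
    IsDerivMeasures (-1) 1 (jumpPow β) (jumpPowDeriv β) 0 := by
  have := isFiniteMeasure_withDensity_jumpPowDensity hβ
  refine ⟨integrableOn_jumpPow hβ, ?_, inferInstance, Measure.MutuallySingular.zero_right, ?_,
    by simp, fun φ hφ hs => ?_⟩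
  · unfold jumpPowDeriv
    infer_instance
  · rw [jumpPowDeriv, withDensity_jumpPowDensity, Measure.add_apply, add_eq_zero]
    refine ⟨by simp [measurableSet_Ioo], withDensity_absolutelyContinuous _ _ ?_⟩
    rw [Measure.restrict_apply measurableSet_Ioo.compl]
    simp
  · rw [integral_jumpPow_mul_deriv hβ hφ hs, integral_jumpPowDeriv hβ hφ.continuous]
    simp

theorem zero_mem_ZPlus_jumpPow {β : ℝ} (hβ0 : 0 < β) (hβ1 : β < 1) :
    (0 : ℝ) ∈ ZPlus (-1) 1 (uaD (jumpPowDeriv β) 0) := by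
  refine ⟨by norm_num, ?_⟩
  refine (tendsto_rpow_neg_nhdsGT_zero (show β - 1 < 0 by linarith)).congr' ?_
  filter_upwards [Ioo_mem_nhdsGT (zero_lt_one' ℝ)] with ε hε
  have hsub : Ioo (0 - ε) (0 + ε) ⊆ Ioo (-1 : ℝ) 1 :=
    Ioo_subset_Ioo (by linarith [hε.2]) (by linarith [hε.2])
  rw [integral_congr_ae (ae_restrict_of_ae_restrict_of_subset hsub (uaD_jumpPowDeriv hβ0)),
    ← integral_Ioc_eq_integral_Ioo,
    ← intervalIntegral.integral_of_le (by linarith [hε.1]), integral_abs_rpow_sub_one hβ0,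
    oddPow_of_nonneg hβ0 (by linarith [hε.1]), oddPow_of_nonpos hβ0 (by linarith [hε.1])]
  have hε0 : 0 < ε := hε.1
  simp only [zero_add, zero_sub, abs_neg, abs_of_pos hε0]
  rw [Real.rpow_sub_one hε0.ne']
  field_simp
  ring

theorem Psip_truncated_power {α p : ℝ} (t : ℝ) :
    Psip (fun t => if |t| ≤ 1 then 1 else 1 / |t| ^ α) p t =
      ∫ s in Iic t, max 1 |s| ^ (-(α / p)) := by
  unfold Psip
  congr 1
  funext s
  dsimp only
  split_ifs with h
  · simp [max_eq_left h]
  · rw [max_eq_right (le_of_not_ge h), one_div, ← Real.rpow_neg (abs_nonneg s),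
      ← Real.rpow_mul (abs_nonneg s)]
    congr 1
    ring

/-- a concrete discontinuous function in `X^p_ψ(]-1,1[)`.
Here `ψ(t) = 1` for `|t| ≤ 1`, `ψ(t) = 1/|t|^α` for `|t| > 1` (`α > 1`),
`p ∈ ]1,(α+1)/2[`, `0 < β < 1 - (p-1)/(α-p)`, and
`u(x) = -|x|^β` for `x ≤ 0`, `u(x) = 1 + x^β` for `x > 0`, whose absolutely
continuous derivative is `β|x|^{β-1}`. -/
theorem statement_7 (α p β : ℝ) (hα : 1 < α) (hp1 : 1 < p) (hp2 : p < (α + 1) / 2)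
    (hβ0 : 0 < β) (hβ1 : β < 1 - (p - 1) / (α - p)) :
    MemW1pOn p (-1) 1
      (fun x => Psip (fun t => if |t| ≤ 1 then 1 else 1 / |t| ^ α) p (β * |x| ^ (β - 1))) ∧
    ∃ μp μn : Measure ℝ,
      MemXp (fun t => if |t| ≤ 1 then 1 else 1 / |t| ^ α) p (-1) 1
        (fun x => if x ≤ 0 then -(|x| ^ β) else 1 + x ^ β) μp μn ∧
      -- the function is discontinuous: it has no continuous representative on `]-1,1[`
      ¬ ∃ f : ℝ → ℝ, ContinuousOn f (Set.Ioo (-1 : ℝ) 1) ∧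
        ∀ᵐ x ∂(MeasureTheory.volume.restrict (Set.Ioo (-1 : ℝ) 1)),
          f x = (if x ≤ 0 then -(|x| ^ β) else 1 + x ^ β) := by
  have hαp : 0 < α - p := by linarith
  have hlt : β * (α - p) < (α - p) - (p - 1) := by
    have h := mul_lt_mul_of_pos_right hβ1 hαp
    rwa [sub_mul, one_mul, div_mul_cancel₀ _ hαp.ne'] at h
  have hβ : β < 1 := by
    have : 0 ≤ (p - 1) / (α - p) := div_nonneg (by linarith) hαp.le
    linarith
  have hp0 : 0 < p := by linarith
  have hr : 1 < α / p := by rw [lt_div_iff₀ hp0]; linarith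
  have hexp : -1 < (α / p * (1 - β) + (β - 2)) * p := by
    have : (α / p * (1 - β) + (β - 2)) * p = α * (1 - β) + (β - 2) * p := by
      field_simp
    rw [this]
    nlinarith
  have hW : MemW1pOn p (-1) 1
      (fun x => Psip (fun t => if |t| ≤ 1 then 1 else 1 / |t| ^ α) p (β * |x| ^ (β - 1))) := by
    simp_rw [Psip_truncated_power]
    exact memW1pOn_integral_Iic hr hp1 hβ0 hβ hexp
  refine ⟨hW, jumpPowDeriv β, 0, ⟨isDerivMeasures_jumpPow hβ0, ?_, ?_, ?_⟩,
    not_continuous_representative_jumpPow β⟩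
  · refine hW.congr_ae ?_
    filter_upwards [uaD_jumpPowDeriv hβ0] with x hx
    rw [hx]
  · rw [singularPart_jumpPowDeriv, Measure.dirac_apply, indicator_of_notMem]
    simpa using zero_mem_ZPlus_jumpPow hβ0 hβ
  · rw [Measure.singularPart_zero]
    simp
end
end
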